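/- arXiv:1601.07821 — 2 statements merged into one kernel-verified Lean document; each statement's English description precedes it below -/
import Mathlib

section
/- Let E be a pointed metric space containing a point distinct from its distinguished point 0, and suppose E is metrically convex: for every pair of distinct points x,y ∈ E there is an isometric embedding γ : [0, ρ(x,y)] → E with γ(0) = x and γ(ρ(x,y)) = y. Then SA(E) is not dense in Lip_0(E); indeed, there exists h ∈ Lip_0(E) such that ‖h - f‖ ≥ 1/2 for every f ∈ SA(E). -/
open Filter Topology

/-- `L` is the smallest Lipschitz constant of `f` (the Lipschitz norm of `f`). -/
def IsLipNorm {E : Type*} [PseudoMetricSpace E] (f : E → ℝ) (L : ℝ) : Prop :=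
  IsLeast {K : ℝ | 0 ≤ K ∧ ∀ x y : E, |f x - f y| ≤ K * dist x y} L

/-- `f` attains its (Lipschitz) norm in the strong sense. -/
def StronglyAttains {E : Type*} [PseudoMetricSpace E] (f : E → ℝ) : Prop :=
  ∃ L : ℝ, IsLipNorm f L ∧ ∃ x y : E, x ≠ y ∧ |f x - f y| = L * dist x y

/-- The smallest Lipschitz constant of a Lipschitz function is attained. -/
lemma exists_isLipNorm {E : Type*} [PseudoMetricSpace E] {f : E → ℝ} {K : ℝ} (hK : 0 ≤ K)
    (hf : ∀ x y : E, |f x - f y| ≤ K * dist x y) : ∃ L : ℝ, IsLipNorm f L := by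
  refine ⟨_, IsClosed.isLeast_csInf ?_ ⟨K, hK, hf⟩ ⟨0, fun _ h => h.1⟩⟩
  simp only [Set.ofPred_and, Set.ofPred_forall]
  exact isClosed_Ici.inter (isClosed_iInter fun x => isClosed_iInter fun y =>
    isClosed_le continuous_const (by fun_prop))

/-- A Lipschitz function on the line which increases from `0` to `a` on `[0, a]`, yet fails to be
injective on every nondegenerate interval. -/
lemma exists_lipschitz_not_injOn_Icc {a : ℝ} (ha : 0 < a) :
    ∃ φ : ℝ → ℝ, φ 0 = 0 ∧ φ a = a ∧ (∃ K : ℝ, 0 ≤ K ∧ ∀ s t, |φ s - φ t| ≤ K * |s - t|) ∧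
      ∀ u v, u < v → ∃ u' ∈ Set.Icc u v, ∃ v' ∈ Set.Icc u v, u' ≠ v' ∧ φ u' = φ v' := by
  obtain ⟨U, hQU, hU, hUa⟩ := Set.exists_isOpen_lt_of_lt (μ := MeasureTheory.volume)
    (Set.range ((↑) : ℚ → ℝ)) (ENNReal.ofReal a)
    (by rw [(Set.countable_range _).measure_zero]; simpa using ha)
  set g : ℝ → ℝ := Uᶜ.indicator 1 with hg
  have hgm : Measurable g := measurable_one.indicator hU.measurableSet.compl
  have hg1 : ∀ x, ‖g x‖ ≤ 1 := fun x => by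
    by_cases hx : x ∈ U <;> simp [hg, hx]
  have hgi : ∀ s t, IntervalIntegrable g MeasureTheory.volume s t := fun s t =>
    (intervalIntegrable_const (c := (1 : ℝ))).mono_fun hgm.aestronglyMeasurable
      (Eventually.of_forall fun x => by simpa using hg1 x)
  have hsub : ∀ s t, (∫ x in (0 : ℝ)..s, g x) - ∫ x in (0 : ℝ)..t, g x = ∫ x in t..s, g x :=
    fun s t => intervalIntegral.integral_interval_sub_left (hgi _ _) (hgi _ _)
  set c : ℝ := ∫ x in (0 : ℝ)..a, g x with hc
  have hc0 : 0 < c := by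
    have h1 : c = MeasureTheory.volume.real (Uᶜ ∩ Set.Ioc 0 a) := by
      rw [hc, intervalIntegral.integral_of_le ha.le, hg,
        MeasureTheory.integral_indicator_one hU.measurableSet.compl,
        MeasureTheory.measureReal_restrict_apply hU.measurableSet.compl]
    rw [h1, MeasureTheory.measureReal_def]
    refine ENNReal.toReal_pos (fun h0 => ?_)
      (ne_top_of_le_ne_top (by simp) (MeasureTheory.measure_mono Set.inter_subset_right))
    refine hUa.not_ge ?_
    calc ENNReal.ofReal a = MeasureTheory.volume (Set.Ioc (0 : ℝ) a) := by simp
      _ ≤ MeasureTheory.volume (U ∪ Uᶜ ∩ Set.Ioc 0 a) := MeasureTheory.measure_mono fun x hx => by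
          by_cases h : x ∈ U <;> simp_all
      _ ≤ MeasureTheory.volume U := (MeasureTheory.measure_union_le _ _).trans (by rw [h0, add_zero])
  refine ⟨fun t => a / c * ∫ x in (0 : ℝ)..t, g x, by simp, by field_simp; exact hc.symm,
    ⟨a / c, by positivity, fun s t => ?_⟩, fun u v huv => ?_⟩
  · rw [← mul_sub, hsub, abs_mul, abs_of_pos (div_pos ha hc0)]
    refine mul_le_mul_of_nonneg_left ?_ (by positivity)
    simpa using intervalIntegral.norm_integral_le_of_norm_le_const (a := t) (b := s)
      (fun x _ => hg1 x)
  · obtain ⟨q, huq, hqv⟩ := exists_rat_btwn huv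
    obtain ⟨ε, hε, hball⟩ := Metric.isOpen_iff.1 hU q (hQU ⟨q, rfl⟩)
    obtain ⟨w, hqw, hw⟩ := exists_between (lt_min hqv (lt_add_of_pos_right (q : ℝ) hε))
    rw [lt_min_iff] at hw
    refine ⟨q, ⟨huq.le, hqv.le⟩, w, ⟨(huq.trans hqw).le, hw.1.le⟩, hqw.ne, ?_⟩
    refine sub_eq_zero.1 ?_
    rw [← mul_sub, hsub, intervalIntegral.integral_congr (g := fun _ => 0) fun x hx => ?_]
    · simp
    · rw [Set.uIcc_of_ge hqw.le] at hx
      have hxU : x ∈ U := hball <| by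
        rw [Metric.mem_ball, Real.dist_eq, abs_lt]
        constructor <;> linarith [hx.1, hx.2]
      simp [hg, hxU]

/-- A Lipschitz function attaining its norm at `x, y` is affine along geodesics from `x` to `y`. -/
lemma le_abs_sub_of_geodesic {E : Type*} [PseudoMetricSpace E] {f : E → ℝ} {L : ℝ}
    (hf : ∀ x y : E, |f x - f y| ≤ L * dist x y) {x y : E} (hxy : |f x - f y| = L * dist x y)
    {γ : ℝ → E} (h0 : γ 0 = x) (h1 : γ (dist x y) = y)
    (hγ : ∀ s ∈ Set.Icc (0 : ℝ) (dist x y), ∀ t ∈ Set.Icc (0 : ℝ) (dist x y),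
      dist (γ s) (γ t) = |s - t|)
    {s t : ℝ} (hs : s ∈ Set.Icc 0 (dist x y)) (ht : t ∈ Set.Icc 0 (dist x y)) :
    L * |s - t| ≤ |f (γ s) - f (γ t)| := by
  wlog hst : s ≤ t generalizing s t
  · rw [abs_sub_comm, abs_sub_comm (f _)]
    exact this ht hs (le_of_not_ge hst)
  have hd : (0 : ℝ) ≤ dist x y := dist_nonneg
  have e1 := hf (γ 0) (γ s)
  have e2 := hf (γ t) (γ (dist x y))
  rw [hγ _ ⟨le_rfl, hd⟩ _ hs, h0, zero_sub, abs_neg, abs_of_nonneg hs.1] at e1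
  rw [hγ _ ht _ ⟨hd, le_rfl⟩, h1, abs_sub_comm t, abs_of_nonneg (sub_nonneg.2 ht.2)] at e2
  rw [abs_sub_comm, abs_of_nonneg (sub_nonneg.2 hst)]
  have t1 := abs_sub_le (f x) (f (γ s)) (f y)
  have t2 := abs_sub_le (f (γ s)) (f (γ t)) (f y)
  linarith

theorem stmt3 {E : Type*} [MetricSpace E] (e₀ : E) (hnt : ∃ x : E, x ≠ e₀)
    (hconv : ∀ x y : E, x ≠ y → ∃ γ : ℝ → E, γ 0 = x ∧ γ (dist x y) = y ∧
      ∀ s ∈ Set.Icc (0:ℝ) (dist x y), ∀ t ∈ Set.Icc (0:ℝ) (dist x y),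
        dist (γ s) (γ t) = |s - t|) :
    ∃ h : E → ℝ, h e₀ = 0 ∧ (∃ L : ℝ, IsLipNorm h L) ∧
      ∀ f : E → ℝ, f e₀ = 0 → StronglyAttains f →
        ∀ M : ℝ, IsLipNorm (fun z => h z - f z) M → (1:ℝ)/2 ≤ M := by
 
  obtain ⟨x₀, hx₀⟩ := hnt
  have ha : 0 < dist x₀ e₀ := dist_pos.2 hx₀
  obtain ⟨φ, hφ0, hφa, ⟨K, hK, hφK⟩, hφ⟩ := exists_lipschitz_not_injOn_Icc ha
  refine ⟨fun z => φ (dist z e₀), by simpa using hφ0,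
    exists_isLipNorm hK fun x y => (hφK _ _).trans
      (mul_le_mul_of_nonneg_left (abs_dist_sub_le x y e₀) hK), ?_⟩
  rintro f hf0 ⟨L, ⟨⟨-, hL⟩, -⟩, x, y, hxy, hLxy⟩ M ⟨⟨-, hM⟩, -⟩
  obtain ⟨γ, h0, h1, hγ⟩ := hconv x y hxy
  have hd : 0 < dist x y := dist_pos.2 hxy
  have hML : 1 ≤ M + L := by
    have hM₀ := hM x₀ e₀
    have hL₀ := hL x₀ e₀
    simp only [dist_self, hφ0, hφa, hf0, sub_zero] at hM₀ hL₀
    have := le_abs_self (dist x₀ e₀ - f x₀)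
    have := le_abs_self (f x₀)
    nlinarith
  obtain ⟨s, hs, t, ht, hst, hφst⟩ : ∃ s ∈ Set.Icc 0 (dist x y), ∃ t ∈ Set.Icc 0 (dist x y),
      s ≠ t ∧ φ (dist (γ s) e₀) = φ (dist (γ t) e₀) := by
    have hcont : ContinuousOn (fun t => dist (γ t) e₀) (Set.uIcc 0 (dist x y)) := by
      rw [Set.uIcc_of_le hd.le]
      have : LipschitzOnWith 1 γ (Set.Icc 0 (dist x y)) :=
        LipschitzOnWith.of_dist_le_mul fun s hs t ht => by
          simp [hγ s hs t ht, Real.dist_eq]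
      exact (continuous_id.dist continuous_const).comp_continuousOn this.continuousOn
    have hivt := intermediate_value_uIcc hcont
    rw [Set.uIcc_of_le hd.le] at hivt
    by_cases heq : dist (γ 0) e₀ = dist (γ (dist x y)) e₀
    · exact ⟨0, ⟨le_rfl, hd.le⟩, _, ⟨hd.le, le_rfl⟩, hd.ne, by rw [heq]⟩
    · obtain ⟨u, hu, v, hv, huv, hφuv⟩ := hφ _ _ (inf_lt_sup.2 heq)
      obtain ⟨s, hs, rfl⟩ := hivt hu
      obtain ⟨t, ht, rfl⟩ := hivt hv
      exact ⟨s, hs, t, ht, fun h => huv (by rw [h]), hφuv⟩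
  have hlow := le_abs_sub_of_geodesic hL hLxy h0 h1 hγ hs ht
  have hup := hM (γ s) (γ t)
  simp only [hφst, sub_sub_sub_cancel_left] at hup
  rw [abs_sub_comm, hγ s hs t ht] at hup
  have : L ≤ M := le_of_mul_le_mul_right (hlow.trans hup) (abs_pos.2 (sub_ne_zero.2 hst))
  linarith
end

section
/- Let X be a real Banach space, let f ∈ Lip_0(X) with ‖f‖ = 1, let δ ∈ (0,2), and let x,y ∈ X with x ≠ y be such that (f(x)-f(y))/‖x-y‖ > 1-δ. Then for every h ∈ Lip_0(X) with ‖h‖ = 1 and (h(x)-h(y))/‖x-y‖ = 1, there exists g ∈ Lip_0(X) with ‖g‖ = 1 and ‖f-g‖ < √(2δ), and there exists a sequence of pairs (v_n,w_n) in X×X with v_n ≠ w_n for every n, such that (h(v_n)-h(w_n))/‖v_n-w_n‖ > 1-√(2δ) for all n ∈ ℕ and (g(v_n)-g(w_n))/‖v_n-w_n‖ → 1 as n → ∞. -/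
open Filter Topology

theorem exists_isLipNorm_le {E : Type*} [PseudoMetricSpace E] {f : E → ℝ} {K : ℝ}
    (hK : 0 ≤ K) (hf : ∀ x y : E, |f x - f y| ≤ K * dist x y) :
    ∃ L : ℝ, IsLipNorm f L ∧ L ≤ K := by
  have hbdd : BddBelow {K : ℝ | 0 ≤ K ∧ ∀ x y : E, |f x - f y| ≤ K * dist x y} :=
    ⟨0, fun _ hK => hK.1⟩
  have hclosed : IsClosed {K : ℝ | 0 ≤ K ∧ ∀ x y : E, |f x - f y| ≤ K * dist x y} := by
    simp only [Set.ofPred_and, Set.ofPred_forall]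
    refine isClosed_Ici.inter (isClosed_iInter fun x => isClosed_iInter fun y => ?_)
    exact isClosed_le continuous_const (by fun_prop)
  exact ⟨_, hclosed.isLeast_csInf ⟨K, hK, hf⟩ hbdd, csInf_le hbdd ⟨hK, hf⟩⟩

theorem IsLipNorm.sub_le {E : Type*} [PseudoMetricSpace E] {f : E → ℝ} {L : ℝ}
    (hf : IsLipNorm f L) (x y : E) : f x - f y ≤ L * dist x y :=
  (le_abs_self _).trans (hf.1.2 x y)

theorem IsLipNorm.div_self {E : Type*} [PseudoMetricSpace E] {f : E → ℝ} {L : ℝ}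
    (hf : IsLipNorm f L) (hL : 0 < L) : IsLipNorm (fun z => f z / L) 1 := by
  refine ⟨⟨zero_le_one, fun x y => ?_⟩, fun K ⟨hK, hKf⟩ => ?_⟩
  · rw [← sub_div, abs_div, abs_of_pos hL, div_le_iff₀ hL]
    linarith [hf.1.2 x y]
  · have : L ≤ K * L := hf.2 ⟨by positivity, fun x y => by
      have := hKf x y
      rw [← sub_div, abs_div, abs_of_pos hL, div_le_iff₀ hL] at this
      linarith⟩
    nlinarith

theorem IsLipNorm.exists_lt_sub {E : Type*} [MetricSpace E] {f : E → ℝ} {L c : ℝ}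
    (hf : IsLipNorm f L) (hc : 0 ≤ c) (hcL : c < L) :
    ∃ v w : E, v ≠ w ∧ c * dist v w < f v - f w := by
  by_contra! H
  have key : ∀ v w : E, f v - f w ≤ c * dist v w := fun v w => by
    rcases eq_or_ne v w with rfl | hvw
    · simp
    · exact H v w hvw
  refine hcL.not_ge (hf.2 ⟨hc, fun v w => abs_le.2 ⟨?_, key v w⟩⟩)
  rw [dist_comm]
  linarith [key w v]

theorem exists_perturbation_weight {δ : ℝ} (hδ0 : 0 < δ) (hδ2 : δ < 2) :
    ∃ l : ℝ, δ ≤ l ∧ δ ≤ l * √(2 * δ) ∧ l < √(2 * δ) ∧ 2 * l < √(2 * δ) * (1 + l) := by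
  have hs0 : 0 < √(2 * δ) := Real.sqrt_pos.2 (by positivity)
  have hsq : √(2 * δ) ^ 2 = 2 * δ := Real.sq_sqrt (by positivity)
  generalize √(2 * δ) = s at hs0 hsq ⊢
  have hs2 : s < 2 := by nlinarith
  have hδ : δ = s ^ 2 / 2 := by linarith
  subst hδ
  rcases le_total s 1 with hs | hs
  · exact ⟨s / 2, by nlinarith, by nlinarith, by linarith, by nlinarith⟩
  · exact ⟨s ^ 2 / 2, le_rfl, by nlinarith, by nlinarith,
      by nlinarith [mul_pos hs0 (show 0 < (s - 1) ^ 2 + 1 by positivity)]⟩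

theorem stmt15 {X : Type*} [NormedAddCommGroup X] [NormedSpace ℝ X] [CompleteSpace X]
    (f : X → ℝ) (hf0 : f 0 = 0) (hf : IsLipNorm f 1)
    (δ : ℝ) (hδ0 : 0 < δ) (hδ2 : δ < 2)
    (x y : X) (hxy : x ≠ y) (hfxy : (f x - f y) / ‖x - y‖ > 1 - δ)
    (h : X → ℝ) (hh0 : h 0 = 0) (hh : IsLipNorm h 1)
    (hhxy : (h x - h y) / ‖x - y‖ = 1) :
    ∃ g : X → ℝ, g 0 = 0 ∧ IsLipNorm g 1 ∧
      (∃ M : ℝ, IsLipNorm (fun z => f z - g z) M ∧ M < Real.sqrt (2 * δ)) ∧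
      ∃ vs ws : ℕ → X, (∀ n, vs n ≠ ws n) ∧
        (∀ n, (h (vs n) - h (ws n)) / ‖vs n - ws n‖ > 1 - Real.sqrt (2 * δ)) ∧
        Tendsto (fun n => (g (vs n) - g (ws n)) / ‖vs n - ws n‖) atTop (𝓝 1) := by
  obtain ⟨l, hδl, hδs, hls, hl2⟩ := exists_perturbation_weight hδ0 hδ2
  set s := √(2 * δ)
  have hl0 : 0 < l := hδ0.trans_le hδl
  have habs : ∀ a b : X, ∀ p q : ℝ, 0 ≤ p → 0 ≤ q →
      |p * (f a - f b)| + |q * (h a - h b)| ≤ (p + q) * dist a b := fun a b p q hp hq => by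
    rw [abs_mul, abs_mul, abs_of_nonneg hp, abs_of_nonneg hq]
    linarith [mul_le_mul_of_nonneg_left (hf.1.2 a b) hp,
      mul_le_mul_of_nonneg_left (hh.1.2 a b) hq]
  obtain ⟨N, hN, hNle⟩ := exists_isLipNorm_le (f := fun z => f z + l * h z) (K := 1 + l)
    (by positivity) fun a b => by
      have h1 : f a + l * h a - (f b + l * h b) = 1 * (f a - f b) + l * (h a - h b) := by ring
      rw [h1]
      exact (abs_add_le _ _).trans (habs a b 1 l zero_le_one hl0.le)
  have hNgt : 1 + l - δ < N := by
    have hd : 0 < ‖x - y‖ := norm_pos_iff.2 (sub_ne_zero.2 hxy)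
    have h1 := hN.sub_le x y
    rw [gt_iff_lt, lt_div_iff₀ hd] at hfxy
    rw [div_eq_iff hd.ne'] at hhxy
    rw [dist_eq_norm] at h1
    refine lt_of_mul_lt_mul_right ?_ hd.le
    calc (1 + l - δ) * ‖x - y‖ = (1 - δ) * ‖x - y‖ + l * (1 * ‖x - y‖) := by ring
      _ < f x - f y + l * (h x - h y) := by rw [hhxy]; linarith
      _ ≤ N * ‖x - y‖ := by linarith
  have hN0 : 0 < N := by linarith
  have hg := hN.div_self hN0
  refine ⟨fun z => (f z + l * h z) / N, by simp [hf0, hh0], hg, ?_, ?_⟩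
  · obtain ⟨M, hM, hMle⟩ := exists_isLipNorm_le
      (f := fun z => f z - (f z + l * h z) / N) (K := (N - 1 + l) / N)
      (div_nonneg (by linarith) hN0.le) fun a b => by
        have h1 := (abs_sub _ _).trans (habs a b (N - 1) l (by linarith) hl0.le)
        have h2 : f a - (f a + l * h a) / N - (f b - (f b + l * h b) / N)
            = ((N - 1) * (f a - f b) - l * (h a - h b)) / N := by
          field_simp
          ring
        rw [h2, abs_div, abs_of_pos hN0, div_mul_eq_mul_div]
        gcongr
    refine ⟨M, hM, hMle.trans_lt ?_⟩
    rw [div_lt_iff₀ hN0]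
    rcases le_total s 1 with hs | hs <;> nlinarith
  · have hσ : 0 < N - (1 + l - δ) := by linarith
    have hε : ∀ n : ℕ, (N - (1 + l - δ)) * (1 / ((n : ℝ) + 1)) ≤ N - (1 + l - δ) := fun n =>
      mul_le_of_le_one_right hσ.le (by rw [div_le_one (by positivity)]; simp)
    have hvw (n : ℕ) := hN.exists_lt_sub
      (c := N - (N - (1 + l - δ)) * (1 / ((n : ℝ) + 1))) (by linarith [hε n])
      (sub_lt_self _ (by positivity))
    choose v w hne hlt using hvw
    have hd (n : ℕ) : 0 < ‖v n - w n‖ := norm_pos_iff.2 (sub_ne_zero.2 (hne n))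
    simp only [dist_eq_norm] at hlt
    refine ⟨v, w, hne, fun n => ?_, ?_⟩
    · rw [gt_iff_lt, lt_div_iff₀ (hd n)]
      have h1 := hf.sub_le (v n) (w n)
      rw [dist_eq_norm] at h1
      have h2 := mul_le_mul_of_nonneg_right (hε n) (hd n).le
      have h3 := mul_le_mul_of_nonneg_right hδs (hd n).le
      refine lt_of_mul_lt_mul_left ?_ hl0.le
      linarith [hlt n]
    · have hlim : Tendsto (fun n : ℕ => (N - (N - (1 + l - δ)) * (1 / ((n : ℝ) + 1))) / N)
          atTop (𝓝 1) := by
        have := ((tendsto_one_div_add_atTop_nhds_zero_nat (𝕜 := ℝ)).const_mul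
          (N - (1 + l - δ))).const_sub N |>.div_const N
        simpa [hN0.ne'] using this
      refine tendsto_of_tendsto_of_tendsto_of_le_of_le hlim tendsto_const_nhds
        (fun n => ?_) (fun n => ?_)
      · dsimp only
        rw [le_div_iff₀ (hd n), ← sub_div, div_mul_eq_mul_div]
        exact div_le_div_of_nonneg_right (hlt n).le hN0.le
      · rw [div_le_iff₀ (hd n), ← dist_eq_norm]
        exact hg.sub_le _ _
end
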